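/- An invertible element T of the Clifford algebra satisfies T C^{(0)} T^{-1} ⊆ C^{(0)} if and only if T ∈ Z^× (C^{×(0)} ∪ C^{×(1)}). Consequently the group preserving the even subspace equals the group preserving the odd subspace. -/

import Mathlib

open CliffordAlgebra

noncomputable section

variable {n : ℕ} (Q : QuadraticForm ℝ (Fin n → ℝ))

/-- The standard generators `e_a` of the Clifford algebra. -/
def egen (a : Fin n) : CliffordAlgebra Q := ι Q (Pi.single a 1)

/-- The ordered product of generators indexed by a finite set. -/
def eProd (s : Finset (Fin n)) : CliffordAlgebra Q :=
  ((s.sort (· ≤ ·)).map (egen Q)).prod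

/-- The grade-`k` subspace `C^k`, spanned by the products of `k` distinct generators. -/
def gradeSubmodule (k : ℕ) : Submodule ℝ (CliffordAlgebra Q) :=
  Submodule.span ℝ {x | ∃ s : Finset (Fin n), s.card = k ∧ x = eProd Q s}

/-- The set `Z^× (C^{×(0)} ∪ C^{×(1)})` : invertible central elements times
invertible even or odd elements. -/
def Pset : Set (CliffordAlgebra Q) :=
  {T | ∃ W T₀ : CliffordAlgebra Q,
    W ∈ Subalgebra.center ℝ (CliffordAlgebra Q) ∧ IsUnit W ∧
    (T₀ ∈ evenOdd Q 0 ∨ T₀ ∈ evenOdd Q 1) ∧ IsUnit T₀ ∧ T = W * T₀}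

/-- `Q` is diagonal with entries `±1` in the standard basis (an orthonormal-type basis,
expressing nondegeneracy of `Q`). -/
def DiagQ : Prop :=
  (∀ a, Q (Pi.single a 1) = 1 ∨ Q (Pi.single a 1) = -1) ∧
  (∀ a b : Fin n, a ≠ b → QuadraticMap.polar Q (Pi.single a 1) (Pi.single b 1) = 0)

section aux
variable {Q}

theorem mem_even_iff (x : CliffordAlgebra Q) : x ∈ evenOdd Q 0 ↔ involute x = x := by
  refine ⟨involute_eq_of_mem_even, fun h => ?_⟩
  have hx : x ∈ evenOdd Q 0 ⊔ evenOdd Q 1 := by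
    rw [(evenOdd_isCompl (Q := Q)).sup_eq_top]; trivial
  obtain ⟨y, hy, w, hw, rfl⟩ := Submodule.mem_sup.1 hx
  rw [map_add, involute_eq_of_mem_even hy, involute_eq_of_mem_odd hw] at h
  have h2 : (2 : ℝ) • w = 0 := by
    rw [two_smul]
    have := add_left_cancel h
    nth_rewrite 1 [← this]
    simp
  have h3 : w = 0 := by simpa using h2
  simpa [h3] using hy

theorem mem_odd_iff (x : CliffordAlgebra Q) : x ∈ evenOdd Q 1 ↔ involute x = -x := by
  refine ⟨involute_eq_of_mem_odd, fun h => ?_⟩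
  have hx : x ∈ evenOdd Q 0 ⊔ evenOdd Q 1 := by
    rw [(evenOdd_isCompl (Q := Q)).sup_eq_top]; trivial
  obtain ⟨y, hy, w, hw, rfl⟩ := Submodule.mem_sup.1 hx
  rw [map_add, involute_eq_of_mem_even hy, involute_eq_of_mem_odd hw, neg_add] at h
  have h2 : (2 : ℝ) • y = 0 := by
    rw [two_smul]
    have := add_right_cancel h
    nth_rewrite 1 [this]
    simp
  have h3 : y = 0 := by simpa using h2
  simpa [h3] using hw

theorem egen_sq (hQ : DiagQ Q) (a : Fin n) :
    ∃ ε : ℝ, ε * ε = 1 ∧ egen Q a * egen Q a = ε • (1 : CliffordAlgebra Q) := by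
  refine ⟨Q (Pi.single a 1), ?_, ?_⟩
  · rcases hQ.1 a with h | h <;> simp [h]
  · rw [egen, ι_sq_scalar, Algebra.algebraMap_eq_smul_one]

theorem egen_anti (hQ : DiagQ Q) {a b : Fin n} (h : a ≠ b) :
    egen Q a * egen Q b = -(egen Q b * egen Q a) := by
  have := ι_mul_ι_add_swap (Q := Q) (Pi.single a 1) (Pi.single b 1)
  rw [hQ.2 a b h, map_zero] at this
  exact eq_neg_of_add_eq_zero_left this

theorem involute_egen (a : Fin n) : involute (egen Q a) = -egen Q a := by
  simp [egen]

theorem egen_cancel (hQ : DiagQ Q) (a : Fin n) {x : CliffordAlgebra Q}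
    (h : egen Q a * x = 0) : x = 0 := by
  obtain ⟨ε, h1, h2⟩ := egen_sq hQ a
  have : (ε * ε) • x = 0 := by
    rw [mul_smul, ← one_mul x, ← smul_mul_assoc ε 1 x, ← h2, mul_assoc, h]; simp
  simpa [h1] using this

theorem adjoin_egen : Algebra.adjoin ℝ (egen Q '' (Set.univ : Set (Fin n))) = ⊤ := by
  rw [eq_top_iff, ← adjoin_range_ι]
  refine Algebra.adjoin_le ?_
  rintro _ ⟨v, rfl⟩
  have hv : v = ∑ i, v i • (Pi.single i (1 : ℝ) : Fin n → ℝ) := by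
    ext j; simp [Finset.sum_apply, Pi.single_apply]
  rw [hv, map_sum]
  refine Subalgebra.sum_mem _ fun i _ => ?_
  rw [map_smul]
  have hi : egen Q i ∈ Algebra.adjoin ℝ (egen Q '' (Set.univ : Set (Fin n))) :=
    Algebra.subset_adjoin ⟨i, trivial, rfl⟩
  exact Subalgebra.smul_mem _ hi _

theorem adjoin_involute (S : Set (Fin n)) {y : CliffordAlgebra Q}
    (hy : y ∈ Algebra.adjoin ℝ (egen Q '' S)) :
    involute y ∈ Algebra.adjoin ℝ (egen Q '' S) := by
  induction hy using Algebra.adjoin_induction with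
  | mem x hx =>
    obtain ⟨a, ha, rfl⟩ := hx
    rw [involute_egen]
    exact neg_mem (Algebra.subset_adjoin ⟨a, ha, rfl⟩)
  | algebraMap r => simp
  | add x y _ _ h1 h2 => rw [map_add]; exact add_mem h1 h2
  | mul x y _ _ h1 h2 => rw [map_mul]; exact mul_mem h1 h2

theorem adjoin_twist (hQ : DiagQ Q) (S : Set (Fin n)) {a : Fin n} (ha : a ∉ S)
    {y : CliffordAlgebra Q} (hy : y ∈ Algebra.adjoin ℝ (egen Q '' S)) :
    y * egen Q a = egen Q a * involute y := by
  induction hy using Algebra.adjoin_induction with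
  | mem x hx =>
    obtain ⟨b, hb, rfl⟩ := hx
    rw [involute_egen, egen_anti hQ (a := b) (b := a) (by rintro rfl; exact ha hb), mul_neg]
  | algebraMap r => rw [AlgHom.commutes, Algebra.commutes]
  | add x y _ _ h1 h2 => rw [map_add, add_mul, mul_add, h1, h2]
  | mul x y _ _ h1 h2 => rw [map_mul, mul_assoc, h2, ← mul_assoc, h1, mul_assoc]

theorem adjoin_split (hQ : DiagQ Q) (S : Set (Fin n)) {a : Fin n} (ha : a ∉ S)
    {x : CliffordAlgebra Q} (hx : x ∈ Algebra.adjoin ℝ (egen Q '' (insert a S))) :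
    ∃ y ∈ Algebra.adjoin ℝ (egen Q '' S), ∃ w ∈ Algebra.adjoin ℝ (egen Q '' S),
      x = y + egen Q a * w := by
  induction hx using Algebra.adjoin_induction with
  | mem x hx =>
    obtain ⟨b, hb, rfl⟩ := hx
    rcases hb with rfl | hb
    · exact ⟨0, zero_mem _, 1, one_mem _, by simp⟩
    · exact ⟨egen Q b, Algebra.subset_adjoin ⟨b, hb, rfl⟩, 0, zero_mem _, by simp⟩
  | algebraMap r => exact ⟨_, Subalgebra.algebraMap_mem _ r, 0, zero_mem _, by simp⟩
  | add x y _ _ h1 h2 =>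
    obtain ⟨y1, hy1, w1, hw1, rfl⟩ := h1
    obtain ⟨y2, hy2, w2, hw2, rfl⟩ := h2
    exact ⟨_, add_mem hy1 hy2, _, add_mem hw1 hw2, by rw [mul_add]; abel⟩
  | mul x y _ _ h1 h2 =>
    obtain ⟨y1, hy1, w1, hw1, rfl⟩ := h1
    obtain ⟨y2, hy2, w2, hw2, rfl⟩ := h2
    obtain ⟨ε, -, h2⟩ := egen_sq hQ a
    have t1 := adjoin_twist hQ S ha hy1
    have t2 := adjoin_twist hQ S ha hw1
    refine ⟨y1 * y2 + ε • (involute w1 * w2),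
      add_mem (mul_mem hy1 hy2) (Subalgebra.smul_mem _ (mul_mem (adjoin_involute S hw1) hw2) _),
      involute y1 * w2 + w1 * y2,
      add_mem (mul_mem (adjoin_involute S hy1) hw2) (mul_mem hw1 hy2), ?_⟩
    have e1 : y1 * (egen Q a * w2) = egen Q a * (involute y1 * w2) := by
      rw [← mul_assoc, t1, mul_assoc]
    have e2 : egen Q a * w1 * (egen Q a * w2) = ε • (involute w1 * w2) := by
      rw [mul_assoc, ← mul_assoc w1, t2, mul_assoc, ← mul_assoc, h2, smul_mul_assoc, one_mul]
    rw [add_mul, mul_add, mul_add, e1, e2, mul_add, mul_assoc]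
    abel

/-- Twisted-central elements are scalars. -/
theorem twisted_scalar (hQ : DiagQ Q) {x : CliffordAlgebra Q}
    (hx : ∀ a, x * egen Q a = egen Q a * involute x) : ∃ r : ℝ, x = r • 1 := by
  have key : ∀ S : Finset (Fin n), x ∈ Algebra.adjoin ℝ (egen Q '' (S : Set (Fin n))) →
      x ∈ Algebra.adjoin ℝ (egen Q '' (∅ : Set (Fin n))) := by
    intro S
    induction S using Finset.induction_on with
    | empty => intro h; simpa using h
    | insert a S ha ih =>
      intro h
      apply ih
      rw [Finset.coe_insert] at h
      have ha' : a ∉ (S : Set (Fin n)) := by simpa using ha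
      obtain ⟨y, hy, w, hw, hxe⟩ := adjoin_split hQ _ ha' h
      have h1 := hx a
      have t1 := adjoin_twist hQ _ ha' hy
      have t2 := adjoin_twist hQ _ ha' hw
      rw [hxe, map_add, map_mul, involute_egen, add_mul, mul_add, t1, mul_assoc, t2] at h1
      have h3 := add_left_cancel h1
      have h4 : egen Q a * (egen Q a * ((2 : ℝ) • involute w)) = 0 := by
        rw [two_smul, mul_add, mul_add]
        nth_rewrite 1 [h3]
        simp
      have h5 := egen_cancel hQ a (egen_cancel hQ a h4)
      have h6 : involute w = 0 := by simpa using h5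
      have h7 : w = 0 := by rw [← involute_involute w, h6, map_zero]
      rw [hxe, h7]; simpa using hy
  have h := key Finset.univ (by rw [Finset.coe_univ, adjoin_egen]; trivial)
  rw [Set.image_empty, Algebra.adjoin_empty, Algebra.mem_bot] at h
  obtain ⟨r, rfl⟩ := h
  exact ⟨r, Algebra.algebraMap_eq_smul_one r⟩

theorem central_of_egen {q : CliffordAlgebra Q} (hq : ∀ a, q * egen Q a = egen Q a * q)
    (x : CliffordAlgebra Q) : q * x = x * q := by
  have hx : x ∈ Algebra.adjoin ℝ (egen Q '' (Set.univ : Set (Fin n))) := by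
    rw [adjoin_egen]; trivial
  induction hx using Algebra.adjoin_induction with
  | mem x hx => obtain ⟨a, -, rfl⟩ := hx; exact hq a
  | algebraMap r => rw [Algebra.commutes]
  | add x y _ _ h1 h2 => rw [add_mul, mul_add, h1, h2]
  | mul x y _ _ h1 h2 => rw [← mul_assoc, h1, mul_assoc, h2, mul_assoc]

theorem anti_of_egen {p : CliffordAlgebra Q} (hp : ∀ a, p * egen Q a = -(egen Q a * p))
    (x : CliffordAlgebra Q) : p * x = involute x * p := by
  have hx : x ∈ Algebra.adjoin ℝ (egen Q '' (Set.univ : Set (Fin n))) := by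
    rw [adjoin_egen]; trivial
  induction hx using Algebra.adjoin_induction with
  | mem x hx => obtain ⟨a, -, rfl⟩ := hx; rw [hp a, involute_egen, neg_mul]
  | algebraMap r => rw [AlgHom.commutes, Algebra.commutes]
  | add x y _ _ h1 h2 => rw [map_add, add_mul, mul_add, h1, h2]
  | mul x y _ _ h1 h2 => rw [map_mul, ← mul_assoc, h1, mul_assoc, h2, mul_assoc]

/-- An element commuting with the even part splits as central plus anticentral. -/
theorem comm_split (hQ : DiagQ Q) (a0 : Fin n) {x : CliffordAlgebra Q}
    (hx : ∀ U ∈ evenOdd Q 0, x * U = U * x) :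
    ∃ y w : CliffordAlgebra Q, x = y + w ∧ (∀ a, y * egen Q a = egen Q a * y) ∧
      (∀ a, w * egen Q a = -(egen Q a * w)) ∧
      (involute x = x → involute y = y ∧ involute w = w) ∧
      (involute x = -x → involute y = -y ∧ involute w = -w) := by
  obtain ⟨ε, h1, h2⟩ := egen_sq hQ a0
  set s : CliffordAlgebra Q := ε • (egen Q a0 * x * egen Q a0) with hs
  have A : ∀ b, egen Q b * s = x * egen Q b := by
    intro b
    have := hx (egen Q b * egen Q a0) (ι_mul_ι_mem_evenOdd_zero _ _ _)
    rw [hs, mul_smul_comm, ← mul_assoc, ← mul_assoc, ← this, mul_assoc, mul_assoc, h2,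
      mul_smul_comm, mul_one, mul_smul_comm, smul_smul, h1, one_smul]
  have B : ∀ b, s * egen Q b = egen Q b * x := by
    intro b
    have := hx (egen Q a0 * egen Q b) (ι_mul_ι_mem_evenOdd_zero _ _ _)
    rw [hs, smul_mul_assoc, mul_assoc, mul_assoc, this, ← mul_assoc, ← mul_assoc, h2,
      smul_mul_assoc, one_mul, smul_mul_assoc, smul_smul, h1, one_smul]
  have C : involute s = ε • (egen Q a0 * involute x * egen Q a0) := by
    rw [hs, map_smul, map_mul, map_mul, involute_egen]; simp
  refine ⟨(1/2 : ℝ) • (x + s), (1/2 : ℝ) • (x - s), by module, ?_, ?_, ?_, ?_⟩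
  · intro a
    rw [smul_mul_assoc, mul_smul_comm, add_mul, mul_add, A, B, add_comm]
  · intro a
    rw [smul_mul_assoc, mul_smul_comm, sub_mul, mul_sub, A, B, ← smul_neg, neg_sub]
  · intro h
    have : involute s = s := by rw [C, h]
    constructor <;> simp [h, this]
  · intro h
    have : involute s = -s := by rw [C, h, hs]; simp
    constructor <;> simp only [map_smul, map_add, map_sub, h, this] <;> module

theorem anti_scalar (hQ : DiagQ Q) (a0 : Fin n) {p : CliffordAlgebra Q} {r : ℝ}
    (hp : p * egen Q a0 = -(egen Q a0 * p)) (h : p = r • 1) : p = 0 := by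
  have : egen Q a0 * ((2 : ℝ) • p) = 0 := by
    have h' : egen Q a0 * p = p * egen Q a0 := by rw [h]; simp
    rw [two_smul, mul_add]
    nth_rewrite 1 [h']
    rw [hp]; simp
  have := egen_cancel hQ a0 this
  simpa using this

theorem odd_scalar {p : CliffordAlgebra Q} {r : ℝ}
    (hp : involute p = -p) (h : p = r • 1) : p = 0 := by
  have h' : involute p = p := by rw [h]; simp
  rw [h'] at hp
  have : (2 : ℝ) • p = 0 := by
    rw [two_smul]; nth_rewrite 1 [hp]; simp
  simpa using this

/-- Structure of the centralizer of the even part. -/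
theorem comm_struct (hQ : DiagQ Q) (a0 : Fin n) {z : CliffordAlgebra Q}
    (hz : ∀ U ∈ evenOdd Q 0, z * U = U * z) :
    ∃ (a : ℝ) (p q : CliffordAlgebra Q), z = a • 1 + p + q ∧
      involute p = p ∧ involute q = -q ∧
      (∀ b, p * egen Q b = -(egen Q b * p)) ∧ (∀ b, q * egen Q b = egen Q b * q) := by
  have hz' : ∀ U ∈ evenOdd Q 0, involute z * U = U * involute z := by
    intro U hU
    have := congrArg involute (hz U hU)
    rwa [map_mul, map_mul, involute_eq_of_mem_even hU] at this
  have i0 : involute ((1/2 : ℝ) • (z + involute z)) = (1/2 : ℝ) • (z + involute z) := by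
    rw [map_smul, map_add, involute_involute, add_comm]
  have i1 : involute ((1/2 : ℝ) • (z - involute z)) = -((1/2 : ℝ) • (z - involute z)) := by
    rw [map_smul, map_sub, involute_involute]; module
  obtain ⟨y0, p, e0, hy0, hp, k0, -⟩ := comm_split hQ a0 (x := (1/2 : ℝ) • (z + involute z))
    (fun U hU => by rw [smul_mul_assoc, mul_smul_comm, add_mul, mul_add, hz U hU, hz' U hU])
  obtain ⟨q, w1, e1, hq, hw1, -, k1⟩ := comm_split hQ a0 (x := (1/2 : ℝ) • (z - involute z))
    (fun U hU => by rw [smul_mul_assoc, mul_smul_comm, sub_mul, mul_sub, hz U hU, hz' U hU])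
  obtain ⟨k0a, k0b⟩ := k0 i0
  obtain ⟨k1a, k1b⟩ := k1 i1
  obtain ⟨a, ha⟩ := twisted_scalar hQ (x := y0) (fun b => by rw [k0a, hy0])
  obtain ⟨r, hr⟩ := twisted_scalar hQ (x := w1) (fun b => by rw [k1b, hw1, mul_neg])
  have hw0 := odd_scalar k1b hr
  refine ⟨a, p, q, ?_, k0b, k1a, hp, hq⟩
  have : z = (1/2 : ℝ) • (z + involute z) + (1/2 : ℝ) • (z - involute z) := by module
  rw [this, e0, e1, hw0, ha]; abel

theorem scalar_inj {r s : ℝ} (h : r • (1 : CliffordAlgebra Q) = s • 1) : r = s := by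
  haveI : Invertible (2 : ℝ) := invertibleOfNonzero two_ne_zero
  rw [← Algebra.algebraMap_eq_smul_one, ← Algebra.algebraMap_eq_smul_one] at h
  exact (algebraMap ℝ (CliffordAlgebra Q)).injective h

theorem isUnit_of_smul {x y : CliffordAlgebra Q} {c : ℝ} (h : x * y = c • 1) (h' : y * x = c • 1)
    (hc : c ≠ 0) : IsUnit x :=
  ⟨⟨x, c⁻¹ • y, by rw [mul_smul_comm, h, smul_smul, inv_mul_cancel₀ hc, one_smul],
    by rw [smul_mul_assoc, h', smul_smul, inv_mul_cancel₀ hc, one_smul]⟩, rfl⟩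

/-- The case with vanishing anticentral part. -/
theorem pset_of_central (T : (CliffordAlgebra Q)ˣ) (a : ℝ) (q : CliffordAlgebra Q)
    (hT : involute (T : CliffordAlgebra Q) = T * (a • 1 + q)) (hq : involute q = -q)
    (hc : ∀ x, q * x = x * q) (t : ℝ) (ht : q * q = t • 1) (hat : a * a - t = 1) :
    (T : CliffordAlgebra Q) ∈ Pset Q := by
  have hT' : involute (T : CliffordAlgebra Q) = a • (T : CliffordAlgebra Q) + T * q := by
    rw [hT, mul_add]; simp
  have cen : ∀ c : ℝ, c • 1 + q ∈ Subalgebra.center ℝ (CliffordAlgebra Q) := fun c =>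
    add_mem (Subalgebra.smul_mem _ (one_mem _) _)
      (Subalgebra.mem_center_iff.2 fun x => (hc x).symm)
  have cen' : ∀ c : ℝ, c • 1 - q ∈ Subalgebra.center ℝ (CliffordAlgebra Q) := fun c =>
    sub_mem (Subalgebra.smul_mem _ (one_mem _) _)
      (Subalgebra.mem_center_iff.2 fun x => (hc x).symm)
  have m1 : ∀ c : ℝ, (c • 1 + q) * (c • 1 - q) = (c * c - t) • (1 : CliffordAlgebra Q) := by
    intro c
    simp only [add_mul, mul_sub, smul_mul_assoc, mul_smul_comm, one_mul, mul_one, ht]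
    module
  have m2 : ∀ c : ℝ, (c • 1 - q) * (c • 1 + q) = (c * c - t) • (1 : CliffordAlgebra Q) := by
    intro c
    simp only [sub_mul, mul_add, smul_mul_assoc, mul_smul_comm, one_mul, mul_one, ht]
    module
  by_cases ha : a = -1
  · subst ha
    have ht0 : t = 0 := by linarith
    have hu : IsUnit ((2 : ℝ) • 1 - q) := isUnit_of_smul (m2 2) (m1 2) (by rw [ht0]; norm_num)
    refine ⟨(2 : ℝ) • 1 + q, (4⁻¹ : ℝ) • ((2 : ℝ) • 1 - q) * T, cen 2,
      isUnit_of_smul (m1 2) (m2 2) (by rw [ht0]; norm_num), Or.inr ?_, ?_, ?_⟩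
    · rw [mem_odd_iff, map_mul, map_smul, map_sub, map_smul, map_one, hq, hT']
      simp only [smul_mul_assoc, sub_neg_eq_add, add_mul, sub_mul, mul_add, one_mul,
        mul_smul_comm]
      rw [← mul_assoc q, hc, mul_assoc (T : CliffordAlgebra Q) q q, ht, ht0]
      simp only [zero_smul, mul_zero]
      module
    · rw [smul_mul_assoc]
      exact (hu.mul T.isUnit).smul (Units.mk0 (4⁻¹ : ℝ) (by norm_num))
    · rw [← mul_assoc, mul_smul_comm, m1, ht0, smul_smul]; norm_num
  · have h1 : (1 + a) * (1 + a) - t ≠ 0 := by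
      intro h; apply ha; nlinarith
    set c := (1 + a) * (1 + a) - t with hcdef
    have hu : IsUnit ((1 + a) • 1 + q) := isUnit_of_smul (m1 _) (m2 _) h1
    refine ⟨(1 + a) • 1 - q, (c⁻¹ : ℝ) • ((1 + a) • 1 + q) * T, cen' _,
      isUnit_of_smul (m2 _) (m1 _) h1, Or.inl ?_, ?_, ?_⟩
    · rw [mem_even_iff, map_mul, map_smul, map_add, map_smul, map_one, hq, hT']
      simp only [smul_mul_assoc]
      congr 1
      simp only [smul_mul_assoc, neg_mul, add_mul, sub_mul, mul_add, one_mul,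
        mul_smul_comm]
      rw [← mul_assoc q, hc, mul_assoc (T : CliffordAlgebra Q) q q, ht, mul_smul_comm, mul_one]
      have : t = a * a - 1 := by linarith
      rw [this]
      module
    · rw [smul_mul_assoc]
      exact (hu.mul T.isUnit).smul (Units.mk0 (c⁻¹ : ℝ) (inv_ne_zero h1))
    · rw [← mul_assoc, mul_smul_comm, m2, smul_smul, ← hcdef, inv_mul_cancel₀ h1, one_smul, one_mul]

theorem pset_of_even (hQ : DiagQ Q) (a0 : Fin n) (T : (CliffordAlgebra Q)ˣ)
    (H : ∀ U ∈ evenOdd Q 0,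
        (↑T : CliffordAlgebra Q) * U * (↑T⁻¹ : CliffordAlgebra Q) ∈ evenOdd Q 0) :
    (T : CliffordAlgebra Q) ∈ Pset Q := by
  obtain ⟨z, hzdef⟩ : ∃ z, z = (↑T⁻¹ : CliffordAlgebra Q) * involute (T : CliffordAlgebra Q) :=
    ⟨_, rfl⟩
  have hT : involute (T : CliffordAlgebra Q) = T * z := by rw [hzdef, Units.mul_inv_cancel_left]
  have hinv : involute (↑T⁻¹ : CliffordAlgebra Q) * involute (T : CliffordAlgebra Q) = 1 := by
    rw [← map_mul, Units.inv_mul, map_one]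
  have hz : ∀ U ∈ evenOdd Q 0, z * U = U * z := by
    intro U hU
    have h := (mem_even_iff _).1 (H U hU)
    rw [map_mul, map_mul, involute_eq_of_mem_even hU] at h
    have h2 := congrArg (fun x => (↑T⁻¹ : CliffordAlgebra Q) * (x * involute (T : CliffordAlgebra Q))) h
    rw [mul_assoc _ _ (involute (T : CliffordAlgebra Q)), hinv, mul_one, ← mul_assoc, ← hzdef,
      mul_assoc _ _ (involute (T : CliffordAlgebra Q)), ← hzdef, mul_assoc, Units.inv_mul_cancel_left]
      at h2
    exact h2
  have hzz : z * involute z = 1 := by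
    have h := congrArg involute hT
    rw [involute_involute, map_mul, hT, mul_assoc] at h
    have h2 := congrArg (fun x => (↑T⁻¹ : CliffordAlgebra Q) * x) h
    simpa using h2.symm
  obtain ⟨a, p, q, hzs, ip, iq, hp, hq⟩ := comm_struct hQ a0 hz
  have cq := central_of_egen hq
  have cp := anti_of_egen hp
  obtain ⟨s, hs⟩ := twisted_scalar hQ (x := p * p) (fun b => by
    rw [map_mul, ip, mul_assoc, hp, mul_neg, ← mul_assoc, hp, neg_mul, neg_neg, mul_assoc])
  obtain ⟨t, ht⟩ := twisted_scalar hQ (x := q * q) (fun b => by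
    rw [map_mul, iq, neg_mul_neg, mul_assoc, hq, ← mul_assoc, hq, mul_assoc])
  have ipq : involute (p * q) = -(p * q) := by rw [map_mul, ip, iq, mul_neg]
  obtain ⟨u, hu⟩ := twisted_scalar hQ (x := p * q) (fun b => by
    rw [ipq, mul_assoc, hq, ← mul_assoc, hp, neg_mul, mul_neg, mul_assoc])
  have hpq := odd_scalar ipq hu
  have hqp : q * p = 0 := by rw [cq, hpq]
  rw [hzs] at hzz
  simp only [map_add, map_smul, map_one, ip, iq, add_mul, mul_add, smul_mul_assoc, mul_smul_comm,
    one_mul, mul_one, mul_neg, hs, ht, hpq, hqp] at hzz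
  have hap : (2 * a) • p = (1 - a * a - s + t) • (1 : CliffordAlgebra Q) := by
    rw [← sub_eq_zero] at hzz ⊢
    refine Eq.trans ?_ hzz
    module
  have hap0 : (2 * a) • p = 0 := anti_scalar hQ a0 (by
    rw [smul_mul_assoc, hp, mul_smul_comm, smul_neg]) hap
  have hsc : 1 - a * a - s + t = 0 := by
    apply scalar_inj (Q := Q); rw [← hap, hap0, zero_smul]
  have p0 : p = 0 := by
    by_contra hne
    have a0' : a = 0 := by
      rcases smul_eq_zero.1 hap0 with h | h
      · linarith
      · exact absurd h hne
    have t0 : t = 0 := by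
      have : t • p = 0 := by
        rw [← mul_one p, ← mul_smul_comm, ← ht, ← mul_assoc, hpq, zero_mul]
      exact (smul_eq_zero.1 this).resolve_right hne
    have s1 : s = 1 := by rw [a0', t0] at hsc; linarith
    have q0 : q = 0 := by
      have : s • q = 0 := by
        rw [← one_mul q, ← smul_mul_assoc, ← hs, mul_assoc, hpq, mul_zero]
      rw [s1, one_smul] at this; exact this
    have hzp : z = p := by rw [hzs, a0', q0]; simp
    have h := cp (T : CliffordAlgebra Q)
    rw [hT, hzp, mul_assoc, hs, mul_smul_comm, mul_one] at h
    have h2 := congrArg (fun x => x * (↑T⁻¹ : CliffordAlgebra Q)) h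
    simp only [smul_mul_assoc, Units.mul_inv, Units.mul_inv_cancel_right] at h2
    exact hne (anti_scalar hQ a0 (hp a0) h2)
  have s0 : s = 0 := by
    apply scalar_inj (Q := Q); rw [← hs, p0]; simp
  refine pset_of_central T a q ?_ iq cq t ht (by linarith)
  rw [hT, hzs, p0, add_zero]

theorem pset_conj {T : (CliffordAlgebra Q)ˣ} (h : (T : CliffordAlgebra Q) ∈ Pset Q)
    (U : CliffordAlgebra Q) :
    involute ((T : CliffordAlgebra Q) * U * (↑T⁻¹ : CliffordAlgebra Q)) =
      (T : CliffordAlgebra Q) * involute U * (↑T⁻¹ : CliffordAlgebra Q) := by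
  obtain ⟨W, S, hW, ⟨w, rfl⟩, hS, ⟨σ, rfl⟩, hT⟩ := h
  have hTu : T = w * σ := Units.ext (by simpa using hT)
  have cw : ∀ V : CliffordAlgebra Q, (T : CliffordAlgebra Q) * V * (↑T⁻¹ : CliffordAlgebra Q) =
      σ * V * (↑σ⁻¹ : CliffordAlgebra Q) := by
    intro V
    rw [hTu, mul_inv_rev, Units.val_mul, Units.val_mul]
    have := Subalgebra.mem_center_iff.1 hW (σ * V * (↑σ⁻¹ : CliffordAlgebra Q))
    calc (w : CliffordAlgebra Q) * σ * V * (↑σ⁻¹ * ↑w⁻¹)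
        = (w : CliffordAlgebra Q) * (σ * V * ↑σ⁻¹) * ↑w⁻¹ := by simp only [mul_assoc]
      _ = _ := by rw [← this, Units.mul_inv_cancel_right]
  rw [cw, cw, map_mul, map_mul]
  have hinv : involute (σ : CliffordAlgebra Q) * involute (↑σ⁻¹ : CliffordAlgebra Q) = 1 := by
    rw [← map_mul, Units.mul_inv, map_one]
  rcases hS with h | h
  · rw [involute_eq_of_mem_even h] at hinv ⊢
    rw [← Units.inv_eq_of_mul_eq_one_right hinv]
  · rw [involute_eq_of_mem_odd h] at hinv ⊢
    have h2 : (σ : CliffordAlgebra Q) * (-involute (↑σ⁻¹ : CliffordAlgebra Q)) = 1 := by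
      rw [mul_neg, ← neg_mul, hinv]
    have h3 := Units.inv_eq_of_mul_eq_one_right h2
    have h4 : involute (↑σ⁻¹ : CliffordAlgebra Q) = -↑σ⁻¹ := neg_eq_iff_eq_neg.1 h3.symm
    rw [h4]
    simp only [neg_mul, mul_neg, neg_neg]

theorem even_of_odd (hQ : DiagQ Q) (a0 : Fin n) (T : (CliffordAlgebra Q)ˣ)
    (H : ∀ U ∈ evenOdd Q 1,
        (↑T : CliffordAlgebra Q) * U * (↑T⁻¹ : CliffordAlgebra Q) ∈ evenOdd Q 1) :
    ∀ U ∈ evenOdd Q 0,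
        (↑T : CliffordAlgebra Q) * U * (↑T⁻¹ : CliffordAlgebra Q) ∈ evenOdd Q 0 := by
  intro U hU
  obtain ⟨ε, h1, h2⟩ := egen_sq hQ a0
  have iU := involute_eq_of_mem_even hU
  have o1 := H (ε • (U * egen Q a0)) (by
    rw [mem_odd_iff, map_smul, map_mul, iU, involute_egen]; simp)
  have o2 := H (egen Q a0) (by rw [mem_odd_iff, involute_egen])
  have i1 := involute_eq_of_mem_odd o1
  have i2 := involute_eq_of_mem_odd o2
  have e : (↑T : CliffordAlgebra Q) * U * (↑T⁻¹ : CliffordAlgebra Q) =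
      (↑T * (ε • (U * egen Q a0)) * ↑T⁻¹) * (↑T * egen Q a0 * ↑T⁻¹) := by
    calc (↑T : CliffordAlgebra Q) * U * (↑T⁻¹ : CliffordAlgebra Q)
        = ↑T * (ε • (U * (egen Q a0 * egen Q a0))) * ↑T⁻¹ := by
          rw [h2, mul_smul_comm ε U, smul_smul, h1, one_smul, mul_one]
      _ = _ := by
          simp only [mul_smul_comm, smul_mul_assoc, mul_assoc, Units.inv_mul_cancel_left]
  rw [mem_even_iff, e, map_mul, i1, i2, neg_mul_neg]

end aux

/-- `Γ^{(0)} = Z^× (C^{×(0)} ∪ C^{×(1)})`, and consequently `Γ^{(0)} = Γ^{(1)}`. -/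
theorem stmt5 (hQ : DiagQ Q) (hn : 2 ≤ n) (T : (CliffordAlgebra Q)ˣ) :
    ((∀ U ∈ evenOdd Q 0,
        (↑T : CliffordAlgebra Q) * U * (↑T⁻¹ : CliffordAlgebra Q) ∈ evenOdd Q 0) ↔
      (↑T : CliffordAlgebra Q) ∈ Pset Q) ∧
    ((∀ U ∈ evenOdd Q 0,
        (↑T : CliffordAlgebra Q) * U * (↑T⁻¹ : CliffordAlgebra Q) ∈ evenOdd Q 0) ↔
      (∀ U ∈ evenOdd Q 1,
        (↑T : CliffordAlgebra Q) * U * (↑T⁻¹ : CliffordAlgebra Q) ∈ evenOdd Q 1)) := by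
  have a0 : Fin n := ⟨0, by omega⟩
  have P0 : (↑T : CliffordAlgebra Q) ∈ Pset Q → ∀ U ∈ evenOdd Q 0,
      (↑T : CliffordAlgebra Q) * U * (↑T⁻¹ : CliffordAlgebra Q) ∈ evenOdd Q 0 := by
    intro h U hU
    rw [mem_even_iff, pset_conj h, involute_eq_of_mem_even hU]
  refine ⟨⟨pset_of_even hQ a0 T, P0⟩, fun h U hU => ?_, even_of_odd hQ a0 T⟩
  rw [mem_odd_iff, pset_conj (pset_of_even hQ a0 T h), involute_eq_of_mem_odd hU, mul_neg, neg_mul]
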